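/- For all P_D, P_F ∈ [0,1], each of the following three quantities is nonnegative: C₁ = β_F β_D [(α_F − β_F) + (α_D − β_D)], C₂ = β_F β_D [β_D(α_F − β_F) + β_F(α_D − β_D)], and C₃ = β_F β_D [β_D²(α_F − β_F) + β_F²(α_D − β_D)]. (These are the coefficients C₁, C₂, C₃ of the numerator polynomial of the negated second derivative of the J-divergence objective, shown nonnegative in the paper's proof of its concavity-region Lemma.) -/

import Mathlib

/-- `α_F = P_F(1−P_D) + P_D(P_D−P_F)` -/
noncomputable def alphaF (PD PF : ℝ) : ℝ := PF * (1 - PD) + PD * (PD - PF)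

/-- `α_D = P_D(1−P_F) − P_F(P_D−P_F)` -/
noncomputable def alphaD (PD PF : ℝ) : ℝ := PD * (1 - PF) - PF * (PD - PF)

/-- `β_F = P_D(1−P_D)` -/
noncomputable def betaF (PD : ℝ) : ℝ := PD * (1 - PD)

/-- `β_D = P_F(1−P_F)` -/
noncomputable def betaD (PF : ℝ) : ℝ := PF * (1 - PF)


/-- Nonnegativity of the coefficients `C₁`, `C₂`, `C₃` of the numerator polynomial
of the negated second derivative of the J-divergence objective. -/
theorem C1_C2_C3_nonneg (PD PF : ℝ)
    (hPD : PD ∈ Set.Icc (0 : ℝ) 1) (hPF : PF ∈ Set.Icc (0 : ℝ) 1) :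
    0 ≤ betaF PD * betaD PF
        * ((alphaF PD PF - betaF PD) + (alphaD PD PF - betaD PF))
      ∧ 0 ≤ betaF PD * betaD PF
        * (betaD PF * (alphaF PD PF - betaF PD)
            + betaF PD * (alphaD PD PF - betaD PF))
      ∧ 0 ≤ betaF PD * betaD PF
        * (betaD PF ^ 2 * (alphaF PD PF - betaF PD)
            + betaF PD ^ 2 * (alphaD PD PF - betaD PF)) := by
  obtain ⟨hx0, hx1⟩ := hPD
  obtain ⟨hy0, hy1⟩ := hPF
  have hF : 0 ≤ betaF PD := mul_nonneg hx0 (by linarith)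
  have hD : 0 ≤ betaD PF := mul_nonneg hy0 (by linarith)
  have hb := mul_nonneg hF hD
  obtain ⟨u, hu⟩ : ∃ u, u = 2 * PD - 1 := ⟨_, rfl⟩
  obtain ⟨v, hv⟩ : ∃ v, v = 2 * PF - 1 := ⟨_, rfl⟩
  have hu2 : 0 ≤ 1 - u ^ 2 := by rw [hu]; nlinarith
  have hv2 : 0 ≤ 1 - v ^ 2 := by rw [hv]; nlinarith
  have hp1 : 0 ≤ 1 + u * v := by nlinarith [sq_nonneg (u + v)]
  have hp2 : 0 ≤ 1 - u * v := by nlinarith [sq_nonneg (u - v)]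
  have hK : 0 ≤ 1 + 2 * (u * v) - (u * v) ^ 2 - (u * v) * (u ^ 2 + v ^ 2) := by
    rcases le_total 0 (u * v) with h | h
    · have h1 := mul_nonneg h (mul_nonneg hu2 hv2)
      have h2 := mul_nonneg hp1 (mul_nonneg hp1 hp2)
      nlinarith
    · have h1 := mul_nonneg (neg_nonneg.2 h) (sq_nonneg (u + v))
      nlinarith [sq_nonneg (1 + u * v)]
  refine ⟨mul_nonneg hb ?_, mul_nonneg hb ?_, mul_nonneg hb ?_⟩
  · have : (alphaF PD PF - betaF PD) + (alphaD PD PF - betaD PF) = 2 * (PD - PF) ^ 2 := by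
      unfold alphaF alphaD betaF betaD; ring
    rw [this]; positivity
  · have : betaD PF * (alphaF PD PF - betaF PD) + betaF PD * (alphaD PD PF - betaD PF)
        = (PD - PF) ^ 2 / 2 * (1 + u * v) := by
      rw [hu, hv]; unfold alphaF alphaD betaF betaD; ring
    rw [this]; exact mul_nonneg (by positivity) hp1
  · have : betaD PF ^ 2 * (alphaF PD PF - betaF PD) + betaF PD ^ 2 * (alphaD PD PF - betaD PF)
        = (PD - PF) ^ 2 / 8 *
          (1 + 2 * (u * v) - (u * v) ^ 2 - (u * v) * (u ^ 2 + v ^ 2)) := by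
      rw [hu, hv]; unfold alphaF alphaD betaF betaD; ring
    rw [this]; exact mul_nonneg (by positivity) hK
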